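/- Let w̃ ∈ Wtf, and let w ∈ Wf and w̃⁺ ∈ Wtf⁺ be the unique elements such that w̃ = w · w̃⁺. Then w̃⁺ ≤ w̃ in the Bruhat order on Wtf defined by the dominant base alcove. -/

import Mathlib

/-!
Common setup: the extended affine Weyl group of `GL_n` (f-fold product), its dot
action on `(ℝ^n)^f`, p-alcoves, lengths, Bruhat orders (dominant and antidominant),
the up (↑) order, admissible sets, and the combinatorics of lowest alcove
presentations, following Le–Le Hung–Levin, "Weight elimination in Serre-type
conjectures".
-/

noncomputable section

namespace LLLSerre

open scoped BigOperators

/-- `η₀ = (n-1, n-2, …, 1, 0)`. -/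
def eta0 (n : ℕ) : Fin n → ℤ := fun i => (n : ℤ) - 1 - (i : ℤ)

/-- The action of a permutation on a vector: `(σ x) i = x (σ⁻¹ i)`. -/
def permAct {n : ℕ} {α : Type*} (σ : Equiv.Perm (Fin n)) (x : Fin n → α) : Fin n → α :=
  fun i => x (σ⁻¹ i)

/-- The weight lattice `Xf = (ℤ^n)^f`. -/
abbrev Xf (n f : ℕ) := Fin f → Fin n → ℤ

/-- The f-fold product of Weyl groups `Wf = (S_n)^f`. -/
abbrev WfG (n f : ℕ) := Fin f → Equiv.Perm (Fin n)

/-- Points of `(ℝ^n)^f`. -/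
abbrev RPt (n f : ℕ) := Fin f → Fin n → ℝ

/-- The extended affine Weyl group `Wtf = (X ⋊ W)^f`; the pair `(w, ν)` represents
`w t_ν`. -/
structure Wtf (n f : ℕ) where
  w : WfG n f
  t : Xf n f

/-- Multiplication in `Wtf`: `(w₁ t_{ν₁})(w₂ t_{ν₂}) = w₁w₂ t_{ν₂ + w₂⁻¹(ν₁)}`. -/
def Wtf.mul {n f : ℕ} (a b : Wtf n f) : Wtf n f :=
  ⟨fun j => a.w j * b.w j, fun j => b.t j + permAct (b.w j)⁻¹ (a.t j)⟩

/-- Inversion in `Wtf`: `(w t_ν)⁻¹ = w⁻¹ t_{-w(ν)}`. -/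
def Wtf.inv {n f : ℕ} (a : Wtf n f) : Wtf n f :=
  ⟨fun j => (a.w j)⁻¹, fun j => -(permAct (a.w j) (a.t j))⟩

/-- Embedding of the finite Weyl group `Wf` in `Wtf`. -/
def ofW {n f : ℕ} (w : WfG n f) : Wtf n f := ⟨w, fun _ _ => 0⟩

/-- The translation `t_ν ∈ Wtf`. -/
def transl {n f : ℕ} (ν : Xf n f) : Wtf n f := ⟨fun _ => 1, ν⟩

/-- `η = (η₀, …, η₀) ∈ Xf`. -/
def etaf (n f : ℕ) : Xf n f := fun _ => eta0 n

/-- The longest element `w₀ ∈ Wf`. -/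
def w0f (n f : ℕ) : WfG n f := fun _ => Fin.revPerm

/-- `w₀` as an element of `Wtf`. -/
def w0Elt (n f : ℕ) : Wtf n f := ofW (w0f n f)

/-- `w̃_h = w₀ t_{-η} ∈ Wtf`. -/
def whElt (n f : ℕ) : Wtf n f := ⟨w0f n f, fun _ i => -(eta0 n i)⟩

/-- The dot action of `Wtf` on `(ℝ^n)^f`: `(w t_ν) · x = w(x + η + pν) − η`. -/
def dotR {n f : ℕ} (p : ℕ) (a : Wtf n f) (x : RPt n f) : RPt n f :=
  fun j i =>
    (x j ((a.w j)⁻¹ i) + ((eta0 n ((a.w j)⁻¹ i) : ℤ) : ℝ)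
      + (p : ℝ) * ((a.t j ((a.w j)⁻¹ i) : ℤ) : ℝ)) - ((eta0 n i : ℤ) : ℝ)

/-- The dot action of `Wtf` on integral weights. -/
def dotZ {n f : ℕ} (p : ℕ) (a : Wtf n f) (lam : Xf n f) : Xf n f :=
  fun j i =>
    (lam j ((a.w j)⁻¹ i) + eta0 n ((a.w j)⁻¹ i) + (p : ℤ) * a.t j ((a.w j)⁻¹ i)) - eta0 n i

/-- `⟨x_j + η₀, α_{ik}^∨⟩` for a real point `x`. -/
def prR {n f : ℕ} (x : RPt n f) (j : Fin f) (i k : Fin n) : ℝ :=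
  (x j i + ((eta0 n i : ℤ) : ℝ)) - (x j k + ((eta0 n k : ℤ) : ℝ))

/-- `⟨λ_j + η₀, α_{ik}^∨⟩` for a weight `λ`. -/
def prZ {n f : ℕ} (lam : Xf n f) (j : Fin f) (i k : Fin n) : ℤ :=
  (lam j i + eta0 n i) - (lam j k + eta0 n k)

/-- A point is (p-)regular if it lies on none of the affine hyperplanes
`⟨x_j + η₀, α^∨⟩ = pm`. -/
def regular {n f : ℕ} (p : ℕ) (x : RPt n f) : Prop :=
  ∀ (j : Fin f) (i k : Fin n) (m : ℤ), i < k → prR x j i k ≠ (p : ℝ) * (m : ℝ)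

/-- Two regular points lie in the same p-alcove (same side of every hyperplane). -/
def sameAlcove {n f : ℕ} (p : ℕ) (x y : RPt n f) : Prop :=
  regular p x ∧ regular p y ∧
    ∀ (j : Fin f) (i k : Fin n) (m : ℤ), i < k →
      (prR x j i k < (p : ℝ) * (m : ℝ) ↔ prR y j i k < (p : ℝ) * (m : ℝ))

/-- The root `α_{ik} = e_i - e_k` as a real vector. -/
def rootR {n : ℕ} (i k i' : Fin n) : ℝ :=
  (if i' = i then (1 : ℝ) else 0) - (if i' = k then (1 : ℝ) else 0)

/-- The affine reflection across the hyperplane `⟨x_j + η₀, α_{ik}^∨⟩ = pm`: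
it replaces `x_j` by `x_j − (⟨x_j + η₀, α_{ik}^∨⟩ − pm) α_{ik}`. -/
def reflPt {n f : ℕ} (p : ℕ) (j : Fin f) (i k : Fin n) (m : ℤ) (x : RPt n f) : RPt n f :=
  fun j' i' =>
    if j' = j then x j' i' - (prR x j i k - (p : ℝ) * (m : ℝ)) * rootR i k i' else x j' i'

/-- The origin, a point of the base alcove `C₀` (when `p > n`). -/
def basePt (n f : ℕ) : RPt n f := fun _ _ => 0

/-- The hyperplane indexed by `(j, i, k, m)` separates `x` from `y`. -/
def separates {n f : ℕ} (p : ℕ) (x y : RPt n f) (j : Fin f) (i k : Fin n) (m : ℤ) : Prop :=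
  (prR x j i k < (p : ℝ) * (m : ℝ) ∧ (p : ℝ) * (m : ℝ) < prR y j i k) ∨
  (prR y j i k < (p : ℝ) * (m : ℝ) ∧ (p : ℝ) * (m : ℝ) < prR x j i k)

/-- The length of `a ∈ Wtf` measured from the alcove of the base point `x`:
the number of hyperplanes separating the alcove of `x` from its image under `a`. -/
def lenFrom {n f : ℕ} (p : ℕ) (x : RPt n f) (a : Wtf n f) : ℕ :=
  Set.ncard {q : Fin f × Fin n × Fin n × ℤ |
    q.2.1 < q.2.2.1 ∧ separates p x (dotR p a x) q.1 q.2.1 q.2.2.1 q.2.2.2}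

/-- Length relative to the dominant base alcove `C₀`. -/
def len {n f : ℕ} (p : ℕ) (a : Wtf n f) : ℕ := lenFrom p (basePt n f) a

/-- A point of the antidominant base alcove `w₀ · C₀`. -/
def antiBasePt (n f p : ℕ) : RPt n f := dotR p (w0Elt n f) (basePt n f)

/-- Length relative to the antidominant base alcove `w₀ · C₀`. -/
def lenV {n f : ℕ} (p : ℕ) (a : Wtf n f) : ℕ := lenFrom p (antiBasePt n f p) a

/-- The affine Weyl group `Waf = (Λ_R ⋊ W)^f ⊆ Wtf`. -/
def Waf (n f : ℕ) : Set (Wtf n f) := {a | ∀ j, (∑ i, a.t j i) = 0}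

/-- The stabilizer `Ωf` of the dominant base alcove `C₀`. -/
def Omegaf (n f p : ℕ) : Set (Wtf n f) :=
  {a | sameAlcove p (basePt n f) (dotR p a (basePt n f))}

/-- The stabilizer of the antidominant base alcove `w₀ · C₀`. -/
def OmegaV (n f p : ℕ) : Set (Wtf n f) :=
  {a | sameAlcove p (antiBasePt n f p) (dotR p a (antiBasePt n f p))}

/-- `a ∈ Wtf` acts via the dot action as the affine reflection in a single hyperplane. -/
def isRefl {n f : ℕ} (p : ℕ) (a : Wtf n f) : Prop :=
  ∃ (j : Fin f) (i k : Fin n) (m : ℤ), i < k ∧ ∀ x, dotR p a x = reflPt p j i k m x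

/-- One step of the Bruhat order (relative to the base point `x`):
`u < r u` for `r` a reflection with `ℓ(u) < ℓ(r u)`. -/
def bruhatStepFrom {n f : ℕ} (p : ℕ) (x : RPt n f) (u v : Wtf n f) : Prop :=
  ∃ r, isRefl p r ∧ v = Wtf.mul r u ∧ lenFrom p x u < lenFrom p x v

/-- The Bruhat order on `Wtf` relative to the base alcove with representative
point `x` and stabilizer `Ω`: on `Waf` it is generated by the reflection steps,
and is extended to `Wtf` by `u ω ≤ v ω` for `u ≤ v` in `Waf`, `ω ∈ Ω`. -/
def bruhatLEFrom {n f : ℕ} (p : ℕ) (x : RPt n f) (Om : Set (Wtf n f)) (a b : Wtf n f) : Prop :=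
  ∃ u v ω, u ∈ Waf n f ∧ v ∈ Waf n f ∧ ω ∈ Om ∧
    a = Wtf.mul u ω ∧ b = Wtf.mul v ω ∧
    Relation.ReflTransGen (bruhatStepFrom p x) u v

/-- The Bruhat order on `Wtf` relative to the dominant base alcove. -/
def bruhatLE {n f : ℕ} (p : ℕ) (a b : Wtf n f) : Prop :=
  bruhatLEFrom p (basePt n f) (Omegaf n f p) a b

/-- The Bruhat order on `Wtf` relative to the antidominant base alcove. -/
def bruhatLEV {n f : ℕ} (p : ℕ) (a b : Wtf n f) : Prop :=
  bruhatLEFrom p (antiBasePt n f p) (OmegaV n f p) a b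

/-- The admissible set `Adm(λ) = {w̃ : w̃ ≤ t_{σ(λ)} for some σ ∈ Wf}` (dominant order). -/
def Adm {n f : ℕ} (p : ℕ) (lam : Xf n f) : Set (Wtf n f) :=
  {a | ∃ σ : WfG n f, bruhatLE p a (transl (fun j => permAct (σ j) (lam j)))}

/-- The admissible set `Adm∨(λ)` (antidominant order). -/
def AdmV {n f : ℕ} (p : ℕ) (lam : Xf n f) : Set (Wtf n f) :=
  {a | ∃ σ : WfG n f, bruhatLEV p a (transl (fun j => permAct (σ j) (lam j)))}

/-- The anti-automorphism `w̃ = w t_ν ↦ w̃* = t_{ν*} w*` of `Wtf`, where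
`(w*)_j = (w_{f-1-j})⁻¹` and `(ν*)_j = ν_{f-1-j}`. -/
def wstar {n f : ℕ} (a : Wtf n f) : Wtf n f :=
  ⟨fun j => (a.w (Fin.rev j))⁻¹, fun j => permAct (a.w (Fin.rev j)) (a.t (Fin.rev j))⟩

/-- `ν ↦ ν*` on weights: `(ν*)_j = ν_{f-1-j}`. -/
def xstar {n f : ℕ} (lam : Xf n f) : Xf n f := fun j => lam (Fin.rev j)

/-- The cyclic shift `π` on weights: `(πν)_j = ν_{j-1}`. -/
def sh {n f : ℕ} (ν : Xf n f) : Xf n f := fun j => ν ((finRotate f)⁻¹ j)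

/-- The cyclic shift `π` on `Wf`: `(πσ)_j = σ_{j-1}`. -/
def shW {n f : ℕ} (σ : WfG n f) : WfG n f := fun j => σ ((finRotate f)⁻¹ j)

/-- The `Wf`-part of `^(ν,σ)(w, μ)`, namely `σ w π(σ)⁻¹`. -/
def conjW {n f : ℕ} (σ w : WfG n f) : WfG n f := fun j => σ j * w j * (shW σ j)⁻¹

/-- The `Xf`-part of `^(ν,σ)(w, μ)`, namely `σ(μ) + pν − σwπ(σ)⁻¹ π(ν)`. -/
def conjX {n f : ℕ} (p : ℕ) (ν : Xf n f) (σ w : WfG n f) (μ : Xf n f) : Xf n f :=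
  fun j i => permAct (σ j) (μ j) i + (p : ℤ) * ν j i - permAct (conjW σ w j) (sh ν j) i

/-- `(w, μ) ∼ (w', μ')`: `(w', μ') = ^(ν,σ)(w, μ)` for some `(ν, σ)`. -/
def pairEquiv {n f : ℕ} (p : ℕ) (w : WfG n f) (μ : Xf n f) (w' : WfG n f) (μ' : Xf n f) : Prop :=
  ∃ (ν : Xf n f) (σ : WfG n f), w' = conjW σ w ∧ μ' = conjX p ν σ w μ

/-- `λ` is m-deep in the base alcove `C₀`:
`m < ⟨λ_j + η₀, α^∨⟩ < p − m` for all `j` and positive coroots `α^∨`. -/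
def deep {n f : ℕ} (p m : ℕ) (lam : Xf n f) : Prop :=
  ∀ (j : Fin f) (i k : Fin n), i < k →
    (m : ℤ) < prZ lam j i k ∧ prZ lam j i k < (p : ℤ) - (m : ℤ)

/-- `λ` lies m-deep in its own p-alcove. -/
def deepInAlcove {n f : ℕ} (p m : ℕ) (lam : Xf n f) : Prop :=
  ∀ (j : Fin f) (i k : Fin n), i < k →
    ∃ N : ℤ, (p : ℤ) * N + (m : ℤ) < prZ lam j i k ∧
      prZ lam j i k < (p : ℤ) * (N + 1) - (m : ℤ)

/-- The p-restricted weights `X₁`. -/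
def X1 (n f p : ℕ) : Set (Xf n f) :=
  {lam | ∀ (j : Fin f) (i : Fin n) (h : (i : ℕ) + 1 < n),
    0 ≤ lam j i - lam j ⟨(i : ℕ) + 1, h⟩ ∧ lam j i - lam j ⟨(i : ℕ) + 1, h⟩ ≤ (p : ℤ) - 1}

/-- `X⁰`: weights pairing to 0 with every coroot. -/
def X0 (n f : ℕ) : Set (Xf n f) := {lam | ∀ (j : Fin f) (i k : Fin n), lam j i = lam j k}

/-- The alcove of the regular point `x` is dominant. -/
def dominantPt {n f : ℕ} (x : RPt n f) : Prop :=
  ∀ (j : Fin f) (i k : Fin n), i < k → 0 < prR x j i k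

/-- The alcove of the regular point `x` is p-restricted. -/
def restrictedPt {n f : ℕ} (p : ℕ) (x : RPt n f) : Prop :=
  ∀ (j : Fin f) (i : Fin n) (h : (i : ℕ) + 1 < n),
    0 < prR x j i ⟨(i : ℕ) + 1, h⟩ ∧ prR x j i ⟨(i : ℕ) + 1, h⟩ < (p : ℝ)

/-- `Wtf⁺`: the elements sending `C₀` to a dominant alcove under the dot action. -/
def WtfPlus (n f p : ℕ) : Set (Wtf n f) := {a | dominantPt (dotR p a (basePt n f))}

/-- One step of the up (↑) order on alcoves, via representative points:
stay in the same alcove, or apply a reflection across a hyperplane lying above. -/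
def upStep {n f : ℕ} (p : ℕ) (x y : RPt n f) : Prop :=
  sameAlcove p x y ∨
    ∃ (j : Fin f) (i k : Fin n) (m : ℤ), i < k ∧ prR x j i k < (p : ℝ) * (m : ℝ) ∧
      y = reflPt p j i k m x

/-- The up (↑) order on p-alcoves, via representative points. -/
def alcoveLE {n f : ℕ} (p : ℕ) (x y : RPt n f) : Prop :=
  Relation.ReflTransGen (upStep p) x y

/-- `w̃₁ ↑ w̃₂` on `Wtf`: `w̃₁ · C₀ ↑ w̃₂ · C₀` and `w̃₁, w̃₂` in the same right
`Waf`-coset. -/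
def upOrd {n f : ℕ} (p : ℕ) (a b : Wtf n f) : Prop :=
  alcoveLE p (dotR p a (basePt n f)) (dotR p b (basePt n f)) ∧
    Wtf.mul a (Wtf.inv b) ∈ Waf n f

/-- Realification of an integral weight. -/
def toR {n f : ℕ} (lam : Xf n f) : RPt n f := fun j i => ((lam j i : ℤ) : ℝ)

/-- The `Wf`-orbit of a point of `(ℝ^n)^f`. -/
def orbitR {n f : ℕ} (y : RPt n f) : Set (RPt n f) :=
  Set.range fun σ : WfG n f => fun j => permAct (σ j) (y j)

end LLLSerre

namespace LLLSerre

@[ext]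
theorem Wtf.ext {n f : ℕ} {a b : Wtf n f} (hw : a.w = b.w) (ht : a.t = b.t) : a = b := by
  cases a; cases b; simp_all

theorem Wtf.mul_assoc {n f : ℕ} (a b c : Wtf n f) :
    (a.mul b).mul c = a.mul (b.mul c) := by
  ext j i
  · simp [Wtf.mul]
  · simp [Wtf.mul, permAct]
    ring

theorem Wtf.mul_inv_mul {n f : ℕ} (a b : Wtf n f) : (a.mul b.inv).mul b = a := by
  ext j i
  · simp [Wtf.mul, Wtf.inv]
  · simp [Wtf.mul, Wtf.inv, permAct]

theorem ofW_mul_ofW_mul {n f : ℕ} (v w : WfG n f) (u : Wtf n f) :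
    (ofW v).mul ((ofW w).mul u) = (ofW (v * w)).mul u := by
  ext j i
  · simp [Wtf.mul, ofW]
  · simp [Wtf.mul, ofW, permAct]

theorem ofW_one_mul {n f : ℕ} (u : Wtf n f) : (ofW 1).mul u = u := by
  ext j i
  · simp [Wtf.mul, ofW]
  · simp [Wtf.mul, ofW, permAct]

/-- The integral vector `a · 0 + η`. -/
def orbitVec {n f : ℕ} (p : ℕ) (a : Wtf n f) : Xf n f :=
  fun j i => eta0 n ((a.w j)⁻¹ i) + (p : ℤ) * a.t j ((a.w j)⁻¹ i)

theorem prR_dotR_basePt {n f : ℕ} (p : ℕ) (a : Wtf n f) (j : Fin f) (i k : Fin n) :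
    prR (dotR p a (basePt n f)) j i k = ((orbitVec p a j i - orbitVec p a j k : ℤ) : ℝ) := by
  simp only [prR, dotR, basePt, orbitVec]
  push_cast
  ring

theorem prR_basePt {n f : ℕ} (j : Fin f) (i k : Fin n) :
    prR (basePt n f) j i k = (((k : ℤ) - (i : ℤ) : ℤ) : ℝ) := by
  simp only [prR, basePt, eta0]
  push_cast
  ring

theorem orbitVec_ofW_mul {n f : ℕ} (p : ℕ) (w : WfG n f) (u : Wtf n f) (j : Fin f) (i : Fin n) :
    orbitVec p ((ofW w).mul u) j i = orbitVec p u j ((w j)⁻¹ i) := by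
  simp [orbitVec, Wtf.mul, ofW, permAct]

theorem ofW_mul_mem_Waf {n f : ℕ} (w : WfG n f) {u : Wtf n f} (hu : u ∈ Waf n f) :
    (ofW w).mul u ∈ Waf n f := by
  intro j
  simpa [Wtf.mul, ofW, permAct] using hu j

/-- The hyperplanes separating `η` from `z`, for `n < p`. -/
def sepSet {n f : ℕ} (p : ℕ) (z : Xf n f) : Set (Fin f × Fin n × Fin n × ℤ) :=
  {q | q.2.1 < q.2.2.1 ∧
    ((q.2.2.2 ≤ 0 ∧ z q.1 q.2.1 - z q.1 q.2.2.1 < p * q.2.2.2) ∨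
      (1 ≤ q.2.2.2 ∧ p * q.2.2.2 < z q.1 q.2.1 - z q.1 q.2.2.1))}

theorem lenFrom_basePt {n f p : ℕ} (hnp : n < p) (a : Wtf n f) :
    lenFrom p (basePt n f) a = (sepSet p (orbitVec p a)).ncard := by
  unfold lenFrom
  congr 1
  ext ⟨j, i, k, m⟩
  simp only [sepSet, separates, prR_dotR_basePt, prR_basePt, Set.mem_ofPred_eq]
  refine and_congr_right fun hik => ?_
  have hl : ∀ d : ℤ, (d : ℝ) < (p : ℝ) * m ↔ d < p * m := fun d => by norm_cast
  have hr : ∀ d : ℤ, (p : ℝ) * m < (d : ℝ) ↔ p * m < d := fun d => by norm_cast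
  have hik' : (i : ℤ) < k := by exact_mod_cast hik
  have hk : (k : ℤ) < p := by have := k.isLt; omega
  have hi : (0 : ℤ) ≤ i := by positivity
  have h0 : (p : ℤ) * m < (k : ℤ) - i ↔ m ≤ 0 := by
    constructor
    · intro h
      by_contra hm
      nlinarith
    · intro h
      nlinarith
  have h1 : (k : ℤ) - i < (p : ℤ) * m ↔ 1 ≤ m := by
    constructor
    · intro h
      by_contra hm
      nlinarith
    · intro h
      nlinarith
  rw [hl, hr, hl, hr, h0, h1]
  tauto

theorem sepSet_finite {n f p : ℕ} (hp : 0 < p) (z : Xf n f) : (sepSet p z).Finite := by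
  obtain ⟨B, hB⟩ : ∃ B : ℤ, ∀ q : Fin f × Fin n × Fin n, |z q.1 q.2.1 - z q.1 q.2.2| ≤ B := by
    obtain ⟨B, hB⟩ := (Set.finite_range
      fun q : Fin f × Fin n × Fin n => |z q.1 q.2.1 - z q.1 q.2.2|).bddAbove
    exact ⟨B, fun q => hB ⟨q, rfl⟩⟩
  have hfin : (Set.univ ×ˢ Set.univ ×ˢ Set.univ ×ˢ Set.Icc (-B) B :
      Set (Fin f × Fin n × Fin n × ℤ)).Finite :=
    Set.finite_univ.prod (Set.finite_univ.prod (Set.finite_univ.prod (Set.finite_Icc _ _)))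
  refine hfin.subset ?_
  rintro ⟨j, i, k, m⟩ ⟨-, h⟩
  have hb := abs_le.1 (hB (j, i, k))
  have hp' : (1 : ℤ) ≤ p := by exact_mod_cast hp
  simp only [Set.mem_prod, Set.mem_univ, true_and, Set.mem_Icc]
  simp only at h hb
  rcases h with ⟨hm, h⟩ | ⟨hm, h⟩ <;> constructor <;> nlinarith

/-- The element of `Wf` swapping `i` and `k` in component `j`. -/
def swapAt {n f : ℕ} (j : Fin f) (i k : Fin n) : WfG n f :=
  fun j' => if j' = j then Equiv.swap i k else 1

theorem swapAt_mul_self {n f : ℕ} (j : Fin f) (i k : Fin n) :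
    swapAt j i k * swapAt j i k = 1 := by
  funext j'
  by_cases h : j' = j <;> simp [swapAt, h]

theorem swapAt_inv {n f : ℕ} (j : Fin f) (i k : Fin n) (j' : Fin f) :
    (swapAt j i k j')⁻¹ = swapAt j i k j' := by
  by_cases h : j' = j <;> simp [swapAt, h]

theorem isRefl_ofW_swapAt {n f : ℕ} (p : ℕ) (j : Fin f) {i k : Fin n} (hik : i < k) :
    isRefl p (ofW (swapAt j i k)) := by
  refine ⟨j, i, k, 0, hik, fun x => ?_⟩
  funext j' i'
  by_cases hj : j' = j
  · subst hj
    by_cases hi : i' = i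
    · subst hi
      simp [dotR, reflPt, ofW, swapAt, rootR, prR, hik.ne]
      ring
    · by_cases hk : i' = k
      · subst hk
        simp [dotR, reflPt, ofW, swapAt, rootR, prR, hik.ne']
        ring
      · simp [dotR, reflPt, ofW, swapAt, rootR, hi, hk, Equiv.swap_apply_of_ne_of_ne hi hk]
  · simp [dotR, reflPt, ofW, swapAt, hj]

theorem swap_lt_swap_of_adjacent {n : ℕ} {i k a b : Fin n} (hik : (i : ℕ) + 1 = k)
    (hab : a < b) (hne : ¬ (a = i ∧ b = k)) : Equiv.swap i k a < Equiv.swap i k b := by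
  simp only [Equiv.swap_apply_def]
  split_ifs <;> simp only [Fin.ext_iff, Fin.lt_def] at * <;> omega

/-- Sorting an adjacent pair strictly reduces the number of separating hyperplanes. -/
theorem ncard_sepSet_swapAt_lt {n f p : ℕ} (hp : 0 < p) (z : Xf n f) (j : Fin f) {i k : Fin n}
    (hik : (i : ℕ) + 1 = k) (hz : z j i < z j k) :
    (sepSet p fun j' i' => z j' (swapAt j i k j' i')).ncard < (sepSet p z).ncard := by
  have hlt : i < k := by rw [Fin.lt_def]; omega
  let φ : Fin f × Fin n × Fin n × ℤ → Fin f × Fin n × Fin n × ℤ := fun q =>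
    if q.1 = j ∧ (q.2.1 = i ∧ q.2.2.1 = k ∨ q.2.1 = k ∧ q.2.2.1 = i) then
      (q.1, q.2.1, q.2.2.1, -q.2.2.2)
    else (q.1, swapAt j i k q.1 q.2.1, swapAt j i k q.1 q.2.2.1, q.2.2.2)
  have hφ : Function.Involutive φ := by
    rintro ⟨j', a, b, m⟩
    by_cases hj : j' = j
    · by_cases hab : a = i ∧ b = k ∨ a = k ∧ b = i
      · simp [φ, hj, hab]
      · have hab' : ¬ (Equiv.swap i k a = i ∧ Equiv.swap i k b = k ∨
            Equiv.swap i k a = k ∧ Equiv.swap i k b = i) := by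
          simp only [Equiv.swap_apply_eq_iff, Equiv.swap_apply_left, Equiv.swap_apply_right]
          tauto
        simp [φ, hj, hab, hab', swapAt]
    · simp [φ, hj, swapAt]
  rw [← Set.ncard_image_of_injective _ hφ.injective]
  refine Set.ncard_lt_ncard ⟨?_, fun hsub => ?_⟩ (sepSet_finite hp z)
  · rintro _ ⟨⟨j', a, b, m⟩, ⟨hab, hm⟩, rfl⟩
    simp only at hab hm
    by_cases hj : j' = j
    · subst hj
      by_cases hs : a = i ∧ b = k
      · obtain ⟨rfl, rfl⟩ := hs
        simp only [swapAt, if_true, Equiv.swap_apply_left, Equiv.swap_apply_right] at hm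
        have hm' : 1 ≤ m ∧ p * m < z j' b - z j' a := by
          refine hm.resolve_left fun h => ?_
          nlinarith
        simp only [φ, sepSet, Set.mem_ofPred_eq, and_self, true_or, if_true]
        exact ⟨hab, Or.inl ⟨by omega, by linarith⟩⟩
      · have hs' : ¬ (a = k ∧ b = i) := by
          rintro ⟨rfl, rfl⟩
          exact lt_asymm hab hlt
        simp only [swapAt, if_true] at hm
        simp only [φ, sepSet, Set.mem_ofPred_eq, true_and, hs, hs', or_self, if_false, swapAt,
          if_true]
        exact ⟨swap_lt_swap_of_adjacent hik hab hs, hm⟩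
    · simp only [swapAt, hj, if_false, Equiv.Perm.coe_one, id_eq] at hm
      simpa [φ, hj, swapAt, sepSet, hab] using hm
  · have hmem : (j, i, k, (0 : ℤ)) ∈ sepSet p z :=
      ⟨hlt, Or.inl ⟨le_rfl, by simpa using hz⟩⟩
    obtain ⟨q, hq, hqφ⟩ := hsub hmem
    have hq' : q = (j, i, k, 0) := by
      rw [← hφ q, hqφ]
      simp [φ]
    subst hq'
    simp [sepSet, swapAt] at hq
    omega

theorem reflTransGen_ofW_mul {n f p : ℕ} (hnp : n < p) (u : Wtf n f)
    (hu : ∀ j, StrictAnti (orbitVec p u j)) (w : WfG n f) :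
    Relation.ReflTransGen (bruhatStepFrom p (basePt n f)) u ((ofW w).mul u) := by
  induction h : lenFrom p (basePt n f) ((ofW w).mul u) using Nat.strong_induction_on
    generalizing w with
  | _ N ih =>
    subst h
    by_cases hdom : ∀ j, StrictAnti (orbitVec p ((ofW w).mul u) j)
    · have hw : w = 1 := by
        funext j
        have hmono : StrictMono ((w j)⁻¹ : Equiv.Perm (Fin n)) := fun i k hik => by
          have := hdom j hik
          rw [orbitVec_ofW_mul, orbitVec_ofW_mul] at this
          exact (hu j).lt_iff_gt.1 this
        have := hmono.range_inj (strictMono_id) |>.1 (by simp)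
        exact inv_eq_one.1 (DFunLike.coe_injective this)
      rw [hw, ofW_one_mul]
    · push Not at hdom
      obtain ⟨j, hj⟩ := hdom
      obtain ⟨i, k, hik, hz⟩ : ∃ i k : Fin n, (i : ℕ) + 1 = k ∧
          orbitVec p ((ofW w).mul u) j i < orbitVec p ((ofW w).mul u) j k := by
        by_contra! hcon
        apply hj
        obtain _ | n := n
        · exact fun i => i.elim0
        rw [Fin.strictAnti_iff_succ_lt]
        intro i
        refine lt_of_le_of_ne (hcon i.castSucc i.succ (by simp)) fun heq => ?_
        rw [orbitVec_ofW_mul, orbitVec_ofW_mul] at heq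
        exact (Fin.castSucc_lt_succ (i := i)).ne' ((w j)⁻¹.injective ((hu j).injective heq))
      have hlt : i < k := by rw [Fin.lt_def]; omega
      have hlen : lenFrom p (basePt n f) ((ofW (swapAt j i k * w)).mul u) <
          lenFrom p (basePt n f) ((ofW w).mul u) := by
        rw [lenFrom_basePt hnp, lenFrom_basePt hnp]
        refine lt_of_eq_of_lt ?_ (ncard_sepSet_swapAt_lt (by omega) _ j hik hz)
        congr 2
        funext j' i'
        rw [← ofW_mul_ofW_mul, orbitVec_ofW_mul, swapAt_inv]
      refine (ih _ hlen _ rfl).tail ⟨_, isRefl_ofW_swapAt p j hlt, ?_, hlen⟩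
      rw [ofW_mul_ofW_mul, ← _root_.mul_assoc, swapAt_mul_self, one_mul]

/-- Rotation of `Fin n` by `c`, with the winding numbers of the entries. -/
theorem exists_rotation {n : ℕ} (hn : 0 < n) (c : ℤ) :
    ∃ (σ : Equiv.Perm (Fin n)) (τ : Fin n → ℤ),
      (∀ e : Fin n, (e : ℤ) = σ e - c + n * τ e) ∧ ∑ e, τ e = c := by
  have hn' : (0 : ℤ) < n := by exact_mod_cast hn
  let g : Fin n → Fin n := fun i => ⟨(((i : ℤ) - c) % n).toNat, by
    have := Int.emod_nonneg ((i : ℤ) - c) hn'.ne'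
    have := Int.emod_lt_of_pos ((i : ℤ) - c) hn'
    omega⟩
  have hg : ∀ i, ((g i : ℕ) : ℤ) = ((i : ℤ) - c) % n := fun i =>
    Int.toNat_of_nonneg (Int.emod_nonneg _ hn'.ne')
  have hinj : Function.Injective g := by
    intro i k h
    have h' : ((i : ℤ) - c) ≡ ((k : ℤ) - c) [ZMOD n] := by
      rw [Int.ModEq, ← hg, ← hg, h]
    have h2 : (i : ℤ) ≡ k [ZMOD n] := by simpa using h'.add_right c
    rw [Int.ModEq, Int.emod_eq_of_lt (by positivity) (by exact_mod_cast i.isLt),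
      Int.emod_eq_of_lt (by positivity) (by exact_mod_cast k.isLt)] at h2
    exact Fin.ext (by exact_mod_cast h2)
  let ρ : Equiv.Perm (Fin n) := Equiv.ofBijective g (Finite.injective_iff_bijective.1 hinj)
  have hτ : ∀ e : Fin n, (e : ℤ) = (ρ⁻¹ e : Fin n) - c + n * (-(((ρ⁻¹ e : Fin n) - c : ℤ) / n)) := by
    intro e
    have h := hg (ρ⁻¹ e)
    have he : g (ρ⁻¹ e) = e := ρ.apply_symm_apply e
    rw [he] at h
    have := Int.emod_add_mul_ediv ((ρ⁻¹ e : Fin n) - c : ℤ) n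
    linarith
  refine ⟨ρ⁻¹, _, hτ, ?_⟩
  have hsum := Finset.sum_congr rfl fun e (_ : e ∈ Finset.univ) => hτ e
  rw [Finset.sum_add_distrib, Finset.sum_sub_distrib, ← Finset.mul_sum,
    Equiv.sum_comp (ρ⁻¹) fun e : Fin n => (e : ℤ)] at hsum
  simp only [Finset.sum_const, Finset.card_univ, Fintype.card_fin, nsmul_eq_mul] at hsum
  exact mul_left_cancel₀ hn'.ne' (by linarith)

/-- if `w̃ = w · w̃⁺` with `w ∈ Wf` and `w̃⁺ ∈ Wtf⁺`, then `w̃⁺ ≤ w̃`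
in the Bruhat order relative to the dominant base alcove. -/
theorem statement9 (n f p : ℕ) (hn : 2 ≤ n) (hf : 1 ≤ f) (hp : p.Prime) (hnp : n < p)
    (a aplus : Wtf n f) (w : WfG n f)
    (hplus : aplus ∈ WtfPlus n f p) (hfact : a = Wtf.mul (ofW w) aplus) :
    bruhatLE p aplus a := by
  choose σ τ hτ hsum using fun j => exists_rotation (n := n) (by omega) (∑ i, aplus.t j i)
  have hnp' : (n : ℤ) < p := by exact_mod_cast hnp
  have hlt : ∀ e : Fin n, ((e : ℕ) : ℤ) < n := fun e => by exact_mod_cast e.isLt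
  have hnn : ∀ e : Fin n, (0 : ℤ) ≤ ((e : ℕ) : ℤ) := fun e => by positivity
  let ω : Wtf n f := ⟨σ, τ⟩
  have hω : ω ∈ Omegaf n f p := by
    have key : ∀ (j : Fin f) (i k : Fin n), i < k →
        0 < orbitVec p ω j i - orbitVec p ω j k ∧
          orbitVec p ω j i - orbitVec p ω j k < p := by
      intro j i k hik
      have hik' : ((i : ℕ) : ℤ) < ((k : ℕ) : ℤ) := by exact_mod_cast hik
      have h1 := hτ j ((σ j)⁻¹ i)
      have h2 := hτ j ((σ j)⁻¹ k)
      simp only [Equiv.Perm.coe_inv, Equiv.apply_symm_apply] at h1 h2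
      simp only [orbitVec, eta0, ω]
      generalize (σ j)⁻¹ i = e at *
      generalize (σ j)⁻¹ k = e' at *
      have := hlt e; have := hlt e'; have := hnn e; have := hnn e'
      have := hlt i; have := hlt k; have := hnn i; have := hnn k
      have hd : τ j e = τ j e' ∨ τ j e = τ j e' + 1 := by
        have : -1 < τ j e - τ j e' := by by_contra hc; nlinarith
        have : τ j e - τ j e' < 2 := by by_contra hc; nlinarith
        omega
      rcases hd with hd | hd <;> rw [hd] at h1 ⊢ <;> constructor <;> linarith
    have hreg : ∀ d m : ℤ, 0 < d → d < p → (d < p * m ↔ 1 ≤ m) ∧ d ≠ p * m := by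
      intro d m h0 h1
      have hm : m ≤ 0 ∨ 1 ≤ m := by omega
      rcases hm with hm | hm
      · have : (p : ℤ) * m ≤ 0 := by nlinarith
        refine ⟨⟨fun h => by omega, fun h => by omega⟩, by omega⟩
      · have : (p : ℤ) ≤ p * m := by nlinarith
        refine ⟨⟨fun h => by omega, fun h => by omega⟩, by omega⟩
    have key0 : ∀ i k : Fin n, i < k → 0 < (k : ℤ) - (i : ℤ) ∧ (k : ℤ) - (i : ℤ) < p := by
      intro i k hik
      have hik' : ((i : ℕ) : ℤ) < ((k : ℕ) : ℤ) := by exact_mod_cast hik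
      have := hlt k; have := hnn i
      constructor <;> omega
    refine ⟨fun j i k m hik => ?_, fun j i k m hik => ?_, fun j i k m hik => ?_⟩
    · rw [prR_basePt]
      exact_mod_cast (hreg _ m (key0 i k hik).1 (key0 i k hik).2).2
    · rw [prR_dotR_basePt]
      exact_mod_cast (hreg _ m (key j i k hik).1 (key j i k hik).2).2
    · rw [prR_dotR_basePt, prR_basePt]
      have h1 := (hreg _ m (key0 i k hik).1 (key0 i k hik).2).1
      have h2 := (hreg _ m (key j i k hik).1 (key j i k hik).2).1
      exact_mod_cast h1.trans h2.symm
  have hu : aplus.mul ω.inv ∈ Waf n f := by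
    intro j
    have h1 : ∑ i, τ j ((σ j)⁻¹ i) = ∑ i, τ j i := Equiv.sum_comp _ (τ j)
    have h2 : ∑ i, aplus.t j ((σ j)⁻¹ i) = ∑ i, aplus.t j i := Equiv.sum_comp _ (aplus.t j)
    simp [Wtf.mul, Wtf.inv, permAct, ω, Finset.sum_add_distrib] at h1 h2 ⊢
    rw [h1, h2, hsum]
    ring
  have hdom : ∀ j, StrictAnti (orbitVec p (aplus.mul ω.inv) j) := by
    intro j i k hik
    have hpos := hplus j i k hik
    rw [prR_dotR_basePt] at hpos
    have hpos' : 0 < orbitVec p aplus j i - orbitVec p aplus j k := by exact_mod_cast hpos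
    simp only [orbitVec, Wtf.mul, Wtf.inv, permAct, ω, eta0, Pi.add_apply, Pi.neg_apply,
      mul_inv_rev, inv_inv, Equiv.Perm.coe_mul, Function.comp_apply,
      Equiv.Perm.coe_inv, Equiv.symm_apply_apply] at hpos' ⊢
    have hne : (aplus.w j)⁻¹ i ≠ (aplus.w j)⁻¹ k := (Equiv.injective _).ne hik.ne
    generalize (aplus.w j)⁻¹ i = e at *
    generalize (aplus.w j)⁻¹ k = e' at *
    have h1 := hτ j e
    have h2 := hτ j e'
    have hne' : ((e : ℕ) : ℤ) ≠ ((e' : ℕ) : ℤ) := by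
      exact_mod_cast fun h => hne (Fin.ext h)
    have := hlt e; have := hlt e'; have := hnn e; have := hnn e'
    have := hlt (σ j e); have := hlt (σ j e'); have := hnn (σ j e); have := hnn (σ j e')
    rcases lt_or_gt_of_ne hne' with hee | hee
    · have ht : aplus.t j e' ≤ aplus.t j e := by by_contra hc; nlinarith
      have hd : τ j e' = τ j e ∨ τ j e' = τ j e + 1 := by
        have : -1 < τ j e' - τ j e := by by_contra hc; nlinarith
        have : τ j e' - τ j e < 2 := by by_contra hc; nlinarith
        omega
      rcases hd with hd | hd <;> rw [hd] at h2 ⊢ <;> nlinarith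
    · have ht : aplus.t j e' + 1 ≤ aplus.t j e := by by_contra hc; nlinarith
      have hd : τ j e = τ j e' ∨ τ j e = τ j e' + 1 := by
        have : -1 < τ j e - τ j e' := by by_contra hc; nlinarith
        have : τ j e - τ j e' < 2 := by by_contra hc; nlinarith
        omega
      rcases hd with hd | hd <;> rw [hd] at h1 ⊢ <;> nlinarith
  refine ⟨aplus.mul ω.inv, (ofW w).mul (aplus.mul ω.inv), ω, hu, ofW_mul_mem_Waf w hu, hω,
    (Wtf.mul_inv_mul _ _).symm, ?_, reflTransGen_ofW_mul hnp _ hdom w⟩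
  rw [Wtf.mul_assoc, Wtf.mul_inv_mul, hfact]

end LLLSerre
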